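/- (Upper Contact Jets Theorem) Let w be λ-quasi-convex on an open set U ⊆ ℝⁿ with an upper contact jet (p₀, A₀) at x₀ ∈ U, and let E ⊆ U be a set of full Lebesgue measure in a neighborhood of x₀. Then there is a sequence x_j ∈ E with x_j → x₀ such that w is twice differentiable at each x_j, Dw(x_j) → p₀ = Dw(x₀), and D²w(x_j) → A for some symmetric matrix A with A ≤ A₀ (i.e. A₀ - A positive semidefinite). -/

import Mathlib

open scoped RealInnerProductSpace Topology
open Filter MeasureTheory

/-- The quadratic form `⟨A v, v⟩` associated to a matrix `A`. -/
noncomputable def quad {n : ℕ} (A : Matrix (Fin n) (Fin n) ℝ)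
    (v : EuclideanSpace ℝ (Fin n)) : ℝ :=
  ∑ i, ∑ j, A i j * v i * v j

/-- `(p, A)` is an upper contact jet for `w` at `x₀`. -/
def UpperContactJet {n : ℕ} (w : EuclideanSpace ℝ (Fin n) → ℝ)
    (x₀ p : EuclideanSpace ℝ (Fin n)) (A : Matrix (Fin n) (Fin n) ℝ) : Prop :=
  ∀ᶠ y in 𝓝 x₀, w y ≤ w x₀ + ⟪p, y - x₀⟫ + (1 / 2) * quad A (y - x₀)

/-- `w` is twice differentiable at `x` with gradient `g` and Hessian `H`, in the sense of
a second-order Taylor expansion. -/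
def TwiceDiffAt {n : ℕ} (w : EuclideanSpace ℝ (Fin n) → ℝ)
    (x g : EuclideanSpace ℝ (Fin n)) (H : Matrix (Fin n) (Fin n) ℝ) : Prop :=
  HasGradientAt w g x ∧
    (fun y => w y - w x - ⟪g, y - x⟫ - (1 / 2) * quad H (y - x)) =o[𝓝 x]
      fun y => ‖y - x‖ ^ 2

/-- `w` is `lam`-quasi-convex on `U`: `w + (lam/2)|·|²` is convex on `U`. -/
def QCOn {n : ℕ} (lam : ℝ) (U : Set (EuclideanSpace ℝ (Fin n)))
    (w : EuclideanSpace ℝ (Fin n) → ℝ) : Prop :=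
  ConvexOn ℝ U (fun x => w x + (lam / 2) * ‖x‖ ^ 2)


section ConvexAnalysis

open Metric

variable {V : Type*} [NormedAddCommGroup V] [InnerProductSpace ℝ V]

/-- `g` is a subgradient of `u` at `x`, relative to `U`. -/
def IsSubgradientOn (U : Set V) (u : V → ℝ) (x g : V) : Prop :=
  ∀ y ∈ U, u x + ⟪g, y - x⟫ ≤ u y

/-- `u` is touched from above at `x`, on the ball of radius `ρ`, by a paraboloid with slope `g`
and opening `M`. -/
def IsUpperContactOn (ρ M : ℝ) (u : V → ℝ) (x g : V) : Prop :=
  ∀ y ∈ closedBall x ρ, u y ≤ u x + ⟪g, y - x⟫ + M / 2 * ‖y - x‖ ^ 2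

theorem ConvexOn.exists_isSubgradientOn [FiniteDimensional ℝ V] {U : Set V} {u : V → ℝ}
    (hU : IsOpen U) (hu : ConvexOn ℝ U u) {x : V} (hx : x ∈ U) :
    ∃ g, IsSubgradientOn U u x g := by
  have hcont := hu.continuousOn hU
  have hopen : IsOpen {p : V × ℝ | p.1 ∈ U ∧ u p.1 < p.2} := by
    have h1 : ContinuousOn (fun p : V × ℝ => p.2 - u p.1) (U ×ˢ Set.univ) :=
      continuousOn_snd.sub (hcont.comp continuousOn_fst fun p hp => hp.1)
    have h2 := h1.isOpen_inter_preimage (hU.prod isOpen_univ) (isOpen_Ioi (a := (0 : ℝ)))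
    convert h2 using 1
    ext p
    simp
  obtain ⟨f, hf⟩ := geometric_hahn_banach_open_point hu.convex_strict_epigraph hopen
    (x := (x, u x)) (by simp)
  have hsplit (y : V) (t : ℝ) : f (y, t) = f (y, 0) + t * f (0, 1) := by
    have : (y, t) = (y, (0 : ℝ)) + t • ((0 : V), (1 : ℝ)) := by simp
    rw [this, map_add, map_smul, smul_eq_mul]
  have hneg : f (0, 1) < 0 := by
    have := hf (x, u x + 1) ⟨hx, by simp⟩
    rw [hsplit x (u x + 1), hsplit x (u x)] at this
    linarith
  have hle (y : V) (hy : y ∈ U) : f (y, 0) + u y * f (0, 1) ≤ f (x, 0) + u x * f (0, 1) := by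
    have h (t : ℝ) (ht : 0 < t) :
        f (y, 0) + u y * f (0, 1) ≤ f (x, 0) + u x * f (0, 1) + t * (- f (0, 1)) := by
      have := hf (y, u y + t) ⟨hy, by simpa using ht⟩
      rw [hsplit y, hsplit x] at this
      linarith
    refine le_of_forall_pos_le_add fun e he => ?_
    have := h (e / (- f (0, 1))) (div_pos he (by linarith))
    rwa [div_mul_cancel₀ _ (by linarith)] at this
  let l : V →L[ℝ] ℝ := (- (f (0, 1))⁻¹) • f.comp (ContinuousLinearMap.inl ℝ V ℝ)
  refine ⟨(InnerProductSpace.toDual ℝ V).symm l, fun y hy => ?_⟩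
  rw [InnerProductSpace.toDual_symm_apply]
  have hl : l (y - x) = - (f (0, 1))⁻¹ * (f (y, 0) - f (x, 0)) := by
    rw [← map_sub]
    simp [l]
  rw [hl]
  have h := hle y hy
  have hi : (f (0, 1))⁻¹ < 0 := inv_lt_zero.2 hneg
  have hc : (f (0, 1))⁻¹ * f (0, 1) = 1 := inv_mul_cancel₀ hneg.ne
  have h' := mul_le_mul_of_nonpos_left h hi.le
  have e1 : (f (0, 1))⁻¹ * (f (y, 0) + u y * f (0, 1)) = (f (0, 1))⁻¹ * f (y, 0) + u y := by
    linear_combination u y * hc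
  have e2 : (f (0, 1))⁻¹ * (f (x, 0) + u x * f (0, 1)) = (f (0, 1))⁻¹ * f (x, 0) + u x := by
    linear_combination u x * hc
  rw [e1, e2] at h'
  linarith

theorem IsSubgradientOn.add_inner_le {U : Set V} {u : V → ℝ} {x g x' g' : V} {ρ M : ℝ}
    (hρ : closedBall x ρ ⊆ U) (hg : IsUpperContactOn ρ M u x g)
    (hg' : IsSubgradientOn U u x' g') (hx' : u x + ⟪g, x' - x⟫ ≤ u x') (hM : 0 ≤ M)
    {t : ℝ} (ht : 0 ≤ t) (hb : ‖x' - x‖ + t * ‖g' - g‖ ≤ ρ) :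
    t * ‖g' - g‖ ^ 2 ≤ M / 2 * (‖x' - x‖ + t * ‖g' - g‖) ^ 2 := by
  set d := g' - g with hd
  have hn : ‖x' + t • d - x‖ ≤ ‖x' - x‖ + t * ‖d‖ := by
    have : x' + t • d - x = (x' - x) + t • d := by abel
    rw [this]
    refine (norm_add_le _ _).trans ?_
    rw [norm_smul, Real.norm_of_nonneg ht]
  have hy : x' + t • d ∈ closedBall x ρ := by
    rw [mem_closedBall, dist_eq_norm]
    exact hn.trans hb
  have h1 := hg' _ (hρ hy)
  have h2 := hg _ hy
  have h3 : M / 2 * ‖x' + t • d - x‖ ^ 2 ≤ M / 2 * (‖x' - x‖ + t * ‖d‖) ^ 2 := by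
    gcongr
  have e1 : ⟪g', x' + t • d - x'⟫ = t * ⟪g', d⟫ := by
    rw [add_sub_cancel_left, inner_smul_right]
  have e2 : ⟪g, x' + t • d - x⟫ = ⟪g, x' - x⟫ + t * ⟪g, d⟫ := by
    have : x' + t • d - x = (x' - x) + t • d := by abel
    rw [this, inner_add_right, inner_smul_right]
  have e3 : ‖d‖ ^ 2 = ⟪g', d⟫ - ⟪g, d⟫ := by
    rw [← inner_sub_left, ← hd, real_inner_self_eq_norm_sq]
  rw [e1] at h1
  rw [e2] at h2
  rw [e3]
  linarith

theorem IsSubgradientOn.eq_of_isUpperContactOn {U : Set V} {u : V → ℝ} {x g g' : V} {ρ M : ℝ}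
    (hρ0 : 0 < ρ) (hρ : closedBall x ρ ⊆ U) (hM : 0 ≤ M) (hg : IsUpperContactOn ρ M u x g)
    (hg' : IsSubgradientOn U u x g') : g' = g := by
  by_contra hne
  have hd : 0 < ‖g' - g‖ := norm_pos_iff.2 (sub_ne_zero.2 hne)
  set d := ‖g' - g‖
  set t := min (1 / (M + 1)) (ρ / d)
  have ht : 0 < t := by positivity
  have htM : t * (M + 1) ≤ 1 := by
    have := min_le_left (1 / (M + 1)) (ρ / d)
    rwa [le_div_iff₀ (by positivity)] at this
  have htd : t * d ≤ ρ := by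
    have := min_le_right (1 / (M + 1)) (ρ / d)
    rwa [le_div_iff₀ hd] at this
  have h := hg'.add_inner_le hρ hg (by simp) hM ht.le (by simpa using htd)
  simp only [sub_self, norm_zero, zero_add] at h
  have h1 : t * d ^ 2 * (1 - t * M / 2) ≤ 0 := by
    change t * d ^ 2 ≤ M / 2 * (t * d) ^ 2 at h
    linarith
  have h2 : 0 < t * d ^ 2 * (1 - t * M / 2) := by
    have : 0 < 1 - t * M / 2 := by nlinarith
    positivity
  linarith

theorem IsUpperContactOn.norm_sub_le {U : Set V} {u : V → ℝ} {x g x' g' : V} {ρ M : ℝ}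
    (hρ0 : 0 < ρ) (hρ : closedBall x ρ ⊆ U) (hM : 0 ≤ M) (hg : IsUpperContactOn ρ M u x g)
    (hsub : IsSubgradientOn U u x g) (hg' : IsSubgradientOn U u x' g')
    (hx' : ‖x' - x‖ ≤ ρ / 2) : ‖g' - g‖ ≤ 2 * M * ‖x' - x‖ := by
  rcases eq_or_ne x' x with rfl | hne
  · simp [hg'.eq_of_isUpperContactOn hρ0 hρ hM hg]
  have ha : 0 < ‖x' - x‖ := norm_pos_iff.2 (sub_ne_zero.2 hne)
  rcases (norm_nonneg (g' - g)).eq_or_lt with hd | hd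
  · rw [← hd]; positivity
  have hx'U : x' ∈ U := hρ (by rw [mem_closedBall, dist_eq_norm]; linarith)
  have htd : ‖x' - x‖ / ‖g' - g‖ * ‖g' - g‖ = ‖x' - x‖ := div_mul_cancel₀ _ hd.ne'
  have h := hg'.add_inner_le hρ hg (hsub _ hx'U) hM (t := ‖x' - x‖ / ‖g' - g‖) (by positivity)
    (by rw [htd]; linarith)
  rw [htd, sq ‖g' - g‖, ← mul_assoc, htd] at h
  have : ‖x' - x‖ * ‖g' - g‖ ≤ ‖x' - x‖ * (2 * M * ‖x' - x‖) := by linarith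
  exact le_of_mul_le_mul_left this ha

theorem abs_sub_le_of_forall_abs_sub_le_add_sq {ψ : ℝ → ℝ} {a b : ℝ}
    (h : ∀ s ∈ Set.Icc (0 : ℝ) 1, ∀ t ∈ Set.Icc (0 : ℝ) 1,
      |ψ t - ψ s| ≤ a * |t - s| + b * (t - s) ^ 2) : |ψ 1 - ψ 0| ≤ a := by
  have key (N : ℕ) : |ψ 1 - ψ 0| ≤ a + b * (1 / ((N : ℝ) + 1)) := by
    have hN : (0 : ℝ) < (N : ℝ) + 1 := by positivity
    have htel := Finset.sum_range_sub (fun k : ℕ => ψ (k / ((N : ℝ) + 1))) (N + 1)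
    have hlast : (((N + 1 : ℕ) : ℝ) / ((N : ℝ) + 1)) = 1 := by
      push_cast; exact div_self hN.ne'
    simp only [hlast, Nat.cast_zero, zero_div] at htel
    rw [← htel]
    refine (Finset.abs_sum_le_sum_abs _ _).trans ?_
    have hterm : ∀ k ∈ Finset.range (N + 1),
        |ψ ((k + 1 : ℕ) / ((N : ℝ) + 1)) - ψ (k / ((N : ℝ) + 1))| ≤
          a * (1 / ((N : ℝ) + 1)) + b * (1 / ((N : ℝ) + 1)) ^ 2 := by
      intro k hk
      have hk' : ((k : ℝ) + 1) ≤ (N : ℝ) + 1 := by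
        have := Finset.mem_range.1 hk
        exact_mod_cast this
      have hdiff : ((k + 1 : ℕ) : ℝ) / ((N : ℝ) + 1) - k / ((N : ℝ) + 1) = 1 / ((N : ℝ) + 1) := by
        push_cast; ring
      have := h (k / ((N : ℝ) + 1)) ⟨by positivity, (div_le_one hN).2 (by linarith)⟩
        ((k + 1 : ℕ) / ((N : ℝ) + 1)) ⟨by positivity, (div_le_one hN).2 (by push_cast; linarith)⟩
      rwa [hdiff, abs_of_pos (show (0 : ℝ) < 1 / ((N : ℝ) + 1) by positivity)] at this
    refine (Finset.sum_le_sum hterm).trans (le_of_eq ?_)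
    rw [Finset.sum_const, Finset.card_range, nsmul_eq_mul]
    push_cast
    field_simp
  have hlim : Tendsto (fun N : ℕ => a + b * (1 / ((N : ℝ) + 1))) atTop (𝓝 (a + b * 0)) :=
    (tendsto_one_div_add_atTop_nhds_zero_nat.const_mul b).const_add a
  simpa using ge_of_tendsto' hlim key

/-- A first-order expansion of the subdifferential integrates to a second-order expansion. -/
theorem isLittleO_of_subgradient_expansion [FiniteDimensional ℝ V] {U : Set V} {u : V → ℝ}
    (hU : IsOpen U) (hu : ConvexOn ℝ U u) {x g : V} (hx : x ∈ U) {S : V →L[ℝ] V}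
    (h : ∀ ε > 0, ∃ δ > 0, ∀ y, ‖y - x‖ < δ → ∀ g', IsSubgradientOn U u y g' →
      ‖g' - g - S (y - x)‖ ≤ ε * ‖y - x‖) :
    (fun y => u y - u x - ⟪g, y - x⟫ - 1 / 2 * ⟪S (y - x), y - x⟫) =o[𝓝 x]
      fun y => ‖y - x‖ ^ 2 := by
  rw [Asymptotics.isLittleO_iff]
  intro ε hε
  obtain ⟨δ, hδ, hS⟩ := h ε hε
  obtain ⟨r, hr, hrU⟩ := Metric.isOpen_iff.1 hU x hx
  filter_upwards [ball_mem_nhds x (lt_min hδ hr)] with y hy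
  rw [mem_ball, dist_eq_norm] at hy
  set v := y - x with hv
  have hvδ := hy.trans_le (min_le_left _ _)
  have hvr := hy.trans_le (min_le_right _ _)
  have hnorm (t : ℝ) (ht : t ∈ Set.Icc (0 : ℝ) 1) : ‖t • v‖ ≤ ‖v‖ := by
    rw [norm_smul, Real.norm_of_nonneg ht.1]
    exact mul_le_of_le_one_left (norm_nonneg _) ht.2
  have hmem (t : ℝ) (ht : t ∈ Set.Icc (0 : ℝ) 1) : x + t • v ∈ U :=
    hrU (by
      rw [mem_ball, dist_eq_norm, add_sub_cancel_left]
      exact (hnorm t ht).trans_lt hvr)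
  let ψ : ℝ → ℝ := fun t => u (x + t • v) - t * ⟪g, v⟫ - 1 / 2 * t ^ 2 * ⟪S v, v⟫
  have hone : ∀ s ∈ Set.Icc (0 : ℝ) 1, ∀ t ∈ Set.Icc (0 : ℝ) 1,
      ψ t - ψ s ≤ ε * ‖v‖ ^ 2 * |t - s| + |⟪S v, v⟫| / 2 * (t - s) ^ 2 := by
    intro s hs t ht
    obtain ⟨G, hG⟩ := hu.exists_isSubgradientOn hU (hmem t ht)
    have h1 := hG _ (hmem s hs)
    have e1 : x + s • v - (x + t • v) = (s - t) • v := by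
      rw [sub_smul]; abel
    rw [e1, inner_smul_right] at h1
    have h2 := hS (x + t • v) (by
      rw [add_sub_cancel_left]; exact (hnorm t ht).trans_lt hvδ) G hG
    rw [add_sub_cancel_left] at h2
    have h3 : |⟪G - g - S (t • v), v⟫| ≤ ε * ‖v‖ ^ 2 := by
      refine (abs_real_inner_le_norm _ _).trans ?_
      calc _ ≤ ε * ‖t • v‖ * ‖v‖ := by gcongr
        _ ≤ ε * ‖v‖ * ‖v‖ := by gcongr; exact hnorm t ht
        _ = _ := by ring
    have e2 : ⟪G - g - S (t • v), v⟫ = ⟪G, v⟫ - ⟪g, v⟫ - t * ⟪S v, v⟫ := by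
      rw [inner_sub_left, inner_sub_left, map_smul, real_inner_smul_left]
    have h4 : (t - s) * (⟪G, v⟫ - ⟪g, v⟫ - t * ⟪S v, v⟫) ≤ ε * ‖v‖ ^ 2 * |t - s| := by
      rw [← e2, mul_comm (ε * ‖v‖ ^ 2)]
      refine (le_abs_self _).trans ?_
      rw [abs_mul]
      gcongr
    have h5 : (t - s) ^ 2 * ⟪S v, v⟫ ≤ (t - s) ^ 2 * |⟪S v, v⟫| := by
      gcongr; exact le_abs_self _
    simp only [ψ]
    linarith
  have habs : ∀ s ∈ Set.Icc (0 : ℝ) 1, ∀ t ∈ Set.Icc (0 : ℝ) 1,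
      |ψ t - ψ s| ≤ ε * ‖v‖ ^ 2 * |t - s| + |⟪S v, v⟫| / 2 * (t - s) ^ 2 := by
    intro s hs t ht
    rw [abs_le']
    refine ⟨hone s hs t ht, ?_⟩
    have := hone t ht s hs
    rw [abs_sub_comm s t] at this
    linarith
  have hfin := abs_sub_le_of_forall_abs_sub_le_add_sq habs
  have e : ψ 1 - ψ 0 = u y - u x - ⟪g, v⟫ - 1 / 2 * ⟪S v, v⟫ := by
    simp only [ψ, hv]
    simp
    ring
  rw [e] at hfin
  simpa using hfin

/-- A map sending `y + g` to `y` for each subgradient `g` at `y`. -/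
theorem exists_lipschitzWith_resolvent [FiniteDimensional ℝ V] (U : Set V) (u : V → ℝ) :
    ∃ (R : V → V) (C : NNReal), LipschitzWith C R ∧
      ∀ y ∈ U, ∀ g, IsSubgradientOn U u y g → R (y + g) = y := by
  classical
  let Z : Set V := {z | ∃ y ∈ U, IsSubgradientOn U u y (z - y)}
  have hmono {y y' z z' : V} (hy : y ∈ U) (hy' : y' ∈ U) (h : IsSubgradientOn U u y (z - y))
      (h' : IsSubgradientOn U u y' (z' - y')) : ‖y - y'‖ ≤ ‖z - z'‖ := by
    have h1 := h y' hy'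
    have h2 := h' y hy
    have h3 : ‖y - y'‖ ^ 2 ≤ ⟪z - z', y - y'⟫ := by
      have e1 : ⟪z - y, y' - y⟫ = - ⟪z - y, y - y'⟫ := by rw [← inner_neg_right, neg_sub]
      have e2 : ⟪z - z', y - y'⟫ = ⟪z - y, y - y'⟫ - ⟪z' - y', y - y'⟫ + ‖y - y'‖ ^ 2 := by
        rw [← real_inner_self_eq_norm_sq, ← inner_sub_left, ← inner_add_left]
        congr 1; abel
      rw [e2]
      linarith
    rcases (norm_nonneg (y - y')).eq_or_lt with h0 | h0
    · rw [← h0]; positivity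
    have h4 := h3.trans (real_inner_le_norm _ _)
    rw [sq] at h4
    exact le_of_mul_le_mul_right h4 h0
  let J : V → V := fun z => if h : z ∈ Z then h.choose else 0
  have hJ (z : V) (hz : z ∈ Z) : J z ∈ U ∧ IsSubgradientOn U u (J z) (z - J z) := by
    simp only [J, hz, dite_true]
    exact hz.choose_spec
  have hlip : LipschitzOnWith 1 J Z := LipschitzOnWith.of_dist_le_mul fun z hz z' hz' => by
    rw [dist_eq_norm, dist_eq_norm, NNReal.coe_one, one_mul]
    exact hmono (hJ z hz).1 (hJ z' hz').1 (hJ z hz).2 (hJ z' hz').2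
  obtain ⟨R, hR, hRJ⟩ := hlip.extend_finite_dimension
  refine ⟨R, _, hR, fun y hy g hg => ?_⟩
  have hsub : IsSubgradientOn U u y (y + g - y) := by simpa using hg
  have hz : y + g ∈ Z := ⟨y, hy, hsub⟩
  rw [← hRJ hz]
  have := hmono (hJ _ hz).1 hy (hJ _ hz).2 hsub
  rw [sub_self, norm_zero] at this
  exact sub_eq_zero.1 (norm_le_zero_iff.1 this)

/-- At a point of upper contact where the resolvent has an invertible derivative, the function has
a second-order expansion. -/
theorem IsUpperContactOn.exists_isLittleO [FiniteDimensional ℝ V] {U : Set V} {u : V → ℝ}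
    (hU : IsOpen U) (hu : ConvexOn ℝ U u) {x g : V} {ρ M : ℝ} (hρ0 : 0 < ρ)
    (hρ : closedBall x ρ ⊆ U) (hM : 0 ≤ M) (hg : IsUpperContactOn ρ M u x g)
    (hsub : IsSubgradientOn U u x g) {R : V → V}
    (hR : ∀ y ∈ U, ∀ g, IsSubgradientOn U u y g → R (y + g) = y) {L : V →L[ℝ] V}
    (hL : HasFDerivAt R L (x + g)) (hdet : L.det ≠ 0) :
    ∃ S : V →L[ℝ] V,
      (fun y => u y - u x - ⟪g, y - x⟫ - 1 / 2 * ⟪S (y - x), y - x⟫) =o[𝓝 x]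
        fun y => ‖y - x‖ ^ 2 := by
  have hxU : x ∈ U := hρ (mem_closedBall_self hρ0.le)
  let Le := L.toContinuousLinearEquivOfDetNeZero hdet
  let I : V →L[ℝ] V := Le.symm
  have hI (z : V) : I (L z) = z := Le.symm_apply_apply z
  refine ⟨I - ContinuousLinearMap.id ℝ V,
    isLittleO_of_subgradient_expansion hU hu hxU fun ε hε => ?_⟩
  set ε' := ε / ((‖I‖ + 1) * (1 + 2 * M)) with hε'
  have hε'0 : 0 < ε' := by positivity
  obtain ⟨δ', hδ', hδ⟩ := Metric.eventually_nhds_iff.1 (hL.isLittleO.def hε'0)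
  refine ⟨min (ρ / 2) (δ' / (1 + 2 * M)), by positivity, fun y hy g' hg' => ?_⟩
  have hy1 := hy.trans_le (min_le_left _ _)
  have hy2 := hy.trans_le (min_le_right _ _)
  rw [lt_div_iff₀ (by positivity)] at hy2
  have hyU : y ∈ U := hρ (by rw [mem_closedBall, dist_eq_norm]; linarith)
  have hgg := hg.norm_sub_le hρ0 hρ hM hsub hg' hy1.le
  have hz : ‖y + g' - (x + g)‖ ≤ (1 + 2 * M) * ‖y - x‖ := by
    have : y + g' - (x + g) = (y - x) + (g' - g) := by abel
    rw [this]
    refine (norm_add_le _ _).trans ?_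
    linarith
  have h1 := hδ (y := y + g') (by rw [dist_eq_norm]; linarith)
  rw [hR y hyU g' hg', hR x hxU g hsub] at h1
  have e : g' - g - (I - ContinuousLinearMap.id ℝ V) (y - x) =
      - I (y - x - L (y + g' - (x + g))) := by
    rw [map_sub I, hI, sub_apply, ContinuousLinearMap.id_apply]
    abel
  rw [e, norm_neg]
  calc _ ≤ ‖I‖ * (ε' * ‖y + g' - (x + g)‖) := (I.le_opNorm _).trans (by gcongr)
    _ ≤ (‖I‖ + 1) * (ε' * ((1 + 2 * M) * ‖y - x‖)) := by gcongr; linarith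
    _ = ε * ‖y - x‖ := by rw [hε']; field_simp


theorem LipschitzOnWith.addHaar_image_eq_zero [FiniteDimensional ℝ V] [MeasurableSpace V]
    [BorelSpace V] (μ : Measure V) [μ.IsAddHaarMeasure] {f : V → V} {s : Set V} {C : NNReal}
    (hf : LipschitzOnWith C f s) (hs : μ s = 0) : μ (f '' s) = 0 := by
  have hH := isAddHaarMeasure_hausdorffMeasure (E := V)
  have h1 := Measure.absolutelyContinuous_isAddHaarMeasure
    (Measure.hausdorffMeasure (Module.finrank ℝ V : ℝ) : Measure V) μ
  have h2 := Measure.absolutelyContinuous_isAddHaarMeasure μ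
    (Measure.hausdorffMeasure (Module.finrank ℝ V : ℝ) : Measure V)
  refine h2 (le_antisymm ?_ bot_le)
  refine (hf.hausdorffMeasure_image_le (Nat.cast_nonneg _)).trans ?_
  rw [h1 hs, mul_zero]

theorem addHaar_eq_zero_of_dist_le_mul_dist [FiniteDimensional ℝ V] [MeasurableSpace V]
    [BorelSpace V] (μ : Measure V) [μ.IsAddHaarMeasure] {X : V → V} {s : Set V} {C : NNReal}
    (hX : ∀ q ∈ s, ∀ q' ∈ s, dist q q' ≤ C * dist (X q) (X q')) (hs : μ (X '' s) = 0) :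
    μ s = 0 := by
  have hinj : Set.InjOn X s := fun q hq q' hq' h => by
    have := hX q hq q' hq'
    rw [h, dist_self, mul_zero] at this
    exact dist_le_zero.1 this
  have hinv := hinj.leftInvOn_invFunOn
  have hlip : LipschitzOnWith C (Function.invFunOn X s) (X '' s) := by
    refine LipschitzOnWith.of_dist_le_mul ?_
    rintro _ ⟨q, hq, rfl⟩ _ ⟨q', hq', rfl⟩
    rw [hinv hq, hinv hq']
    exact hX q hq q' hq'
  have := hlip.addHaar_image_eq_zero μ hs
  rwa [hinv.image_image] at this

/-- The critical values of a Lipschitz map form a null set, as do the images of the points where it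
is not differentiable. -/
theorem LipschitzWith.addHaar_image_not_differentiable_or_det_eq_zero [FiniteDimensional ℝ V]
    [MeasurableSpace V] [BorelSpace V] (μ : Measure V) [μ.IsAddHaarMeasure] {R : V → V}
    {C : NNReal} (hR : LipschitzWith C R) :
    μ (R '' {z | ¬ DifferentiableAt ℝ R z ∨ (fderiv ℝ R z).det = 0}) = 0 := by
  have hsub : R '' {z | ¬ DifferentiableAt ℝ R z ∨ (fderiv ℝ R z).det = 0} ⊆
      R '' {z | ¬ DifferentiableAt ℝ R z} ∪
        R '' {z | DifferentiableAt ℝ R z ∧ (fderiv ℝ R z).det = 0} := by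
    rw [← Set.image_union]
    refine Set.image_mono fun z hz => ?_
    by_cases h : DifferentiableAt ℝ R z
    · exact Or.inr ⟨h, hz.resolve_left (not_not.2 h)⟩
    · exact Or.inl h
  refine measure_mono_null hsub (measure_union_null ?_ ?_)
  · exact hR.lipschitzOnWith.addHaar_image_eq_zero μ (ae_iff.1 hR.ae_differentiableAt)
  · exact addHaar_image_eq_zero_of_det_fderivWithin_eq_zero μ
      (fun z hz => hz.1.hasFDerivAt.hasFDerivWithinAt) fun z hz => hz.2

theorem exists_isUpperContactOn_of_tilt [FiniteDimensional ℝ V] {u : V → ℝ} {x₀ : V} {r M c : ℝ}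
    (hr : 0 < r) (hc : 0 < c) (hu : ContinuousOn u (closedBall x₀ r))
    (htouch : ∀ y ∈ closedBall x₀ r,
      u y ≤ u x₀ + M / 2 * ‖y - x₀‖ ^ 2 - c * ‖y - x₀‖ ^ 2) {ρ : ℝ} (q : V)
    (hq : ‖q‖ < c * (r - ρ)) :
    ∃ x, c * ‖x - x₀‖ ≤ ‖q‖ ∧ IsUpperContactOn ρ M u x (q + M • (x - x₀)) := by
  have hcont : ContinuousOn (fun y => u y - M / 2 * ‖y - x₀‖ ^ 2 - ⟪q, y - x₀⟫)
      (closedBall x₀ r) := by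
    refine (hu.sub (Continuous.continuousOn ?_)).sub (Continuous.continuousOn ?_) <;> fun_prop
  obtain ⟨x, hx, hmax⟩ := (isCompact_closedBall x₀ r).exists_isMaxOn
    ⟨x₀, mem_closedBall_self hr.le⟩ hcont
  have hxq : c * ‖x - x₀‖ ≤ ‖q‖ := by
    have h1 := hmax (mem_closedBall_self hr.le)
    simp only [Set.mem_ofPred_eq, sub_self, norm_zero, inner_zero_right] at h1
    have h2 := htouch x hx
    have h3 : c * ‖x - x₀‖ * ‖x - x₀‖ ≤ ‖q‖ * ‖x - x₀‖ := by
      have := neg_le_of_abs_le (abs_real_inner_le_norm q (x - x₀))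
      linarith
    rcases (norm_nonneg (x - x₀)).eq_or_lt with h0 | h0
    · rw [← h0, mul_zero]; positivity
    · exact le_of_mul_le_mul_right h3 h0
  refine ⟨x, hxq, fun y hy => ?_⟩
  have hxr : ‖x - x₀‖ ≤ r - ρ := le_of_mul_le_mul_left (hxq.trans hq.le) hc
  have hyr : y ∈ closedBall x₀ r := by
    rw [mem_closedBall] at hy ⊢
    have := dist_triangle y x x₀
    rw [dist_eq_norm x] at this
    linarith
  have h1 := hmax hyr
  simp only [Set.mem_ofPred_eq] at h1
  have e1 : y - x₀ = (y - x) + (x - x₀) := by abel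
  have e2 : ‖y - x₀‖ ^ 2 = ‖y - x‖ ^ 2 + 2 * ⟪y - x, x - x₀⟫ + ‖x - x₀‖ ^ 2 := by
    rw [e1, norm_add_sq_real]
  have e3 : ⟪q, y - x₀⟫ = ⟪q, y - x⟫ + ⟪q, x - x₀⟫ := by rw [e1, inner_add_right]
  rw [e2, e3] at h1
  rw [inner_add_left, real_inner_smul_left, real_inner_comm (y - x) (x - x₀)]
  linarith

/-- A convex function strictly touched from above at `x₀` by a paraboloid of opening `M` has, at
some point of any set of full measure near `x₀`, a second-order expansion with small gradient and
with second-order part between `0` and `M`. -/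
theorem ConvexOn.exists_isLittleO_of_touching [FiniteDimensional ℝ V] [MeasurableSpace V]
    [BorelSpace V] (μ : Measure V) [μ.IsAddHaarMeasure] {U : Set V} {u : V → ℝ}
    (hU : IsOpen U) (hu : ConvexOn ℝ U u) {x₀ : V} {r M c : ℝ} (hr : 0 < r)
    (hrU : closedBall x₀ r ⊆ U) (hM : 0 ≤ M) (hc : 0 < c)
    (htouch : ∀ y ∈ closedBall x₀ r,
      u y ≤ u x₀ + M / 2 * ‖y - x₀‖ ^ 2 - c * ‖y - x₀‖ ^ 2)
    {E : Set V} (hE : μ (closedBall x₀ r \ E) = 0) {η : ℝ} (hη : 0 < η) :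
    ∃ x ∈ E, ‖x - x₀‖ < η ∧ ∃ (g : V) (S : V →L[ℝ] V) (ρ : ℝ), ‖g‖ < η ∧ 0 < ρ ∧
      closedBall x ρ ⊆ U ∧
      IsSubgradientOn U u x g ∧ IsUpperContactOn ρ M u x g ∧
      (fun y => u y - u x - ⟪g, y - x⟫ - 1 / 2 * ⟪S (y - x), y - x⟫) =o[𝓝 x]
        fun y => ‖y - x‖ ^ 2 := by
  obtain ⟨R, C, hRlip, hR⟩ := exists_lipschitzWith_resolvent U u
  set ρ := 4 * r / 5 with hρ
  have hρ0 : 0 < ρ := by positivity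
  obtain ⟨δ, hδ, hδr, hδη, hδg⟩ : ∃ δ > 0, δ ≤ c * (r / 5) ∧ δ ≤ c * η ∧ δ + M * (δ / c) ≤ η := by
    refine ⟨min (c * (r / 5)) (min (c * η) (η / (1 + M / c))), by positivity, min_le_left _ _,
      (min_le_right _ _).trans (min_le_left _ _), ?_⟩
    have := (min_le_right (c * (r / 5)) _).trans (min_le_right (c * η) (η / (1 + M / c)))
    rw [le_div_iff₀ (by positivity)] at this
    refine le_trans (le_of_eq ?_) this
    ring
  have hex (q : V) (hq : q ∈ ball (0 : V) δ) : ∃ x, c * ‖x - x₀‖ ≤ ‖q‖ ∧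
      IsUpperContactOn ρ M u x (q + M • (x - x₀)) := by
    refine exists_isUpperContactOn_of_tilt hr hc ((hu.continuousOn hU).mono hrU) htouch q ?_
    rw [mem_ball_zero_iff] at hq
    have : r - ρ = r / 5 := by rw [hρ]; ring
    rw [this]
    linarith
  choose! X hXq hXc using hex
  have hXr (q : V) (hq : q ∈ ball (0 : V) δ) : ‖X q - x₀‖ < r / 5 := by
    have h1 := hXq q hq
    rw [mem_ball_zero_iff] at hq
    exact lt_of_mul_lt_mul_left (h1.trans_lt (hq.trans_le hδr)) hc.le
  have hball (q : V) (hq : q ∈ ball (0 : V) δ) : closedBall (X q) ρ ⊆ closedBall x₀ r := by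
    refine closedBall_subset_closedBall' ?_
    have := hXr q hq
    rw [dist_eq_norm, hρ]
    linarith
  have hXU (q : V) (hq : q ∈ ball (0 : V) δ) : X q ∈ U :=
    hrU (hball q hq (mem_closedBall_self hρ0.le))
  have hXs (q : V) (hq : q ∈ ball (0 : V) δ) :
      IsSubgradientOn U u (X q) (q + M • (X q - x₀)) := by
    obtain ⟨g, hg⟩ := hu.exists_isSubgradientOn hU (hXU q hq)
    rwa [← hg.eq_of_isUpperContactOn hρ0 ((hball q hq).trans hrU) hM (hXc q hq)]
  have hanti : ∀ q ∈ ball (0 : V) δ, ∀ q' ∈ ball (0 : V) δ,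
      dist q q' ≤ (3 * M).toNNReal * dist (X q) (X q') := by
    intro q hq q' hq'
    rw [Real.coe_toNNReal _ (by positivity), dist_comm, dist_comm (X q), dist_eq_norm,
      dist_eq_norm]
    have h1 : ‖X q' - X q‖ ≤ ρ / 2 := by
      have e : X q' - X q = (X q' - x₀) - (X q - x₀) := by abel
      rw [e]
      have := norm_sub_le (X q' - x₀) (X q - x₀)
      have := hXr q hq
      have := hXr q' hq'
      rw [hρ]
      linarith
    have h2 := (hXc q hq).norm_sub_le hρ0 ((hball q hq).trans hrU) hM (hXs q hq) (hXs q' hq') h1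
    have e : q' - q = (q' + M • (X q' - x₀) - (q + M • (X q - x₀))) - M • (X q' - X q) := by
      module
    rw [e]
    refine (norm_sub_le _ _).trans ?_
    rw [norm_smul, Real.norm_of_nonneg hM]
    linarith
  set N := R '' {z | ¬ DifferentiableAt ℝ R z ∨ (fderiv ℝ R z).det = 0} with hN
  obtain ⟨q, hq, hqE, hqN⟩ : ∃ q ∈ ball (0 : V) δ, X q ∈ E ∧ X q ∉ N := by
    by_contra! hcon
    have hnull : μ (X '' ball 0 δ) = 0 := by
      refine measure_mono_null ?_ (measure_union_null hE
        (hRlip.addHaar_image_not_differentiable_or_det_eq_zero μ))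
      rintro _ ⟨q, hq, rfl⟩
      by_cases h : X q ∈ E
      · exact Or.inr (hcon q hq h)
      · exact Or.inl ⟨hball q hq (mem_closedBall_self hρ0.le), h⟩
    exact (measure_ball_pos μ (0 : V) hδ).ne' (addHaar_eq_zero_of_dist_le_mul_dist μ hanti hnull)
  set g := q + M • (X q - x₀) with hg
  have hRz : R (X q + g) = X q := hR _ (hXU q hq) _ (hXs q hq)
  have hgood : DifferentiableAt ℝ R (X q + g) ∧ (fderiv ℝ R (X q + g)).det ≠ 0 := by
    by_contra h
    exact hqN ⟨X q + g, by rwa [not_and_or, not_not] at h, hRz⟩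
  obtain ⟨S, hS⟩ := (hXc q hq).exists_isLittleO hU hu hρ0 ((hball q hq).trans hrU) hM
    (hXs q hq) hR hgood.1.hasFDerivAt hgood.2
  have hqδ := mem_ball_zero_iff.1 hq
  have hXq' := hXq q hq
  refine ⟨X q, hqE, ?_, g, S, ρ, ?_, hρ0, (hball q hq).trans hrU, hXs q hq, hXc q hq, hS⟩
  · exact lt_of_mul_lt_mul_left (hXq'.trans_lt (hqδ.trans_le hδη)) hc.le
  · have h1 : ‖X q - x₀‖ ≤ δ / c := by
      rw [le_div_iff₀ hc]
      linarith
    calc ‖g‖ ≤ ‖q‖ + M * ‖X q - x₀‖ := by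
          refine (norm_add_le _ _).trans ?_
          rw [norm_smul, Real.norm_of_nonneg hM]
      _ ≤ ‖q‖ + M * (δ / c) := by gcongr
      _ < η := by linarith

/-- The quadratic part of a second-order expansion inherits nonnegativity of the remainder. -/
theorem inner_self_nonneg_of_isLittleO {F : V → ℝ} {x : V} {S : V →L[ℝ] V}
    (hF : ∀ᶠ y in 𝓝 x, 0 ≤ F y)
    (h : (fun y => F y - 1 / 2 * ⟪S (y - x), y - x⟫) =o[𝓝 x] fun y => ‖y - x‖ ^ 2) (v : V) :
    0 ≤ ⟪S v, v⟫ := by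
  refine le_of_forall_pos_le_add fun e he => ?_
  have he' : 0 < e / (2 * (‖v‖ ^ 2 + 1)) := by positivity
  have hev := hF.and (h.def he')
  have hlim : Tendsto (fun t : ℝ => x + t • v) (𝓝[>] 0) (𝓝 x) := by
    have : Tendsto (fun t : ℝ => x + t • v) (𝓝 0) (𝓝 (x + (0 : ℝ) • v)) :=
      Continuous.tendsto (by fun_prop) 0
    rw [zero_smul, add_zero] at this
    exact this.mono_left nhdsWithin_le_nhds
  obtain ⟨t, ⟨h1, h2⟩, ht⟩ := ((hlim.eventually hev).and self_mem_nhdsWithin).exists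
  have ht0 : (0 : ℝ) < t := ht
  rw [add_sub_cancel_left, map_smul, real_inner_smul_left, inner_smul_right, norm_smul, norm_pow,
    norm_mul, norm_norm, norm_norm, Real.norm_of_nonneg ht0.le, Real.norm_eq_abs] at h2
  have h3 := (le_abs_self _).trans h2
  have h4 : 0 ≤ t ^ 2 * (⟪S v, v⟫ + 2 * (e / (2 * (‖v‖ ^ 2 + 1))) * ‖v‖ ^ 2) := by
    linarith
  have h5 := nonneg_of_mul_nonneg_right h4 (by positivity)
  have h6 : 2 * (e / (2 * (‖v‖ ^ 2 + 1))) * ‖v‖ ^ 2 ≤ e := by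
    have : 2 * (e / (2 * (‖v‖ ^ 2 + 1))) * ‖v‖ ^ 2 = e * (‖v‖ ^ 2 / (‖v‖ ^ 2 + 1)) := by
      field_simp
    rw [this]
    exact mul_le_of_le_one_right he.le ((div_le_one (by positivity)).2 (by linarith))
  linarith

theorem convexOn_quadratic {D : V →L[ℝ] V} (hD : ∀ v, 0 ≤ ⟪D v, v⟫) (x₀ b : V) (k : ℝ) :
    ConvexOn ℝ Set.univ fun y => 1 / 2 * ⟪D (y - x₀), y - x₀⟫ + ⟪b, y⟫ + k := by
  refine ⟨convex_univ, fun x _ y _ s t hs ht hst => ?_⟩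
  have e1 : s • x + t • y - x₀ = s • (x - x₀) + t • (y - x₀) := by
    have : x₀ = s • x₀ + t • x₀ := by rw [← add_smul, hst, one_smul]
    nth_rewrite 1 [this]
    module
  have e2 : x - y = (x - x₀) - (y - x₀) := by abel
  have h := mul_nonneg (mul_nonneg hs ht) (hD (x - y))
  rw [e2] at h
  simp only [smul_eq_mul, e1, map_add, map_sub, map_smul, inner_add_left, inner_add_right,
    inner_sub_left, inner_sub_right, real_inner_smul_left, inner_smul_right] at h ⊢
  obtain rfl : t = 1 - s := by linarith
  linarith

end ConvexAnalysis

section Matrices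

variable {n : ℕ}

theorem quad_eq_inner (A : Matrix (Fin n) (Fin n) ℝ) (v : EuclideanSpace ℝ (Fin n)) :
    quad A v = ⟪Matrix.toEuclideanCLM (𝕜 := ℝ) A v, v⟫ := by
  simp only [quad, PiLp.inner_apply, Matrix.ofLp_toEuclideanCLM, Matrix.mulVec, dotProduct,
    RCLike.inner_apply, conj_trivial, Finset.mul_sum]
  refine Finset.sum_congr rfl fun i _ => Finset.sum_congr rfl fun j _ => ?_
  ring

theorem quad_add (A B : Matrix (Fin n) (Fin n) ℝ) (v : EuclideanSpace ℝ (Fin n)) :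
    quad (A + B) v = quad A v + quad B v := by
  simp [quad_eq_inner, inner_add_left]

theorem quad_sub (A B : Matrix (Fin n) (Fin n) ℝ) (v : EuclideanSpace ℝ (Fin n)) :
    quad (A - B) v = quad A v - quad B v := by
  simp [quad_eq_inner, inner_sub_left]

theorem quad_smul (c : ℝ) (A : Matrix (Fin n) (Fin n) ℝ) (v : EuclideanSpace ℝ (Fin n)) :
    quad (c • A) v = c * quad A v := by
  simp [quad_eq_inner, real_inner_smul_left]

theorem quad_one (v : EuclideanSpace ℝ (Fin n)) :
    quad (1 : Matrix (Fin n) (Fin n) ℝ) v = ‖v‖ ^ 2 := by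
  rw [quad_eq_inner, map_one, one_apply_eq_self, real_inner_self_eq_norm_sq]

theorem quad_transpose (A : Matrix (Fin n) (Fin n) ℝ) (v : EuclideanSpace ℝ (Fin n)) :
    quad A.transpose v = quad A v := by
  rw [quad, quad, Finset.sum_comm]
  refine Finset.sum_congr rfl fun i _ => Finset.sum_congr rfl fun j _ => ?_
  rw [Matrix.transpose_apply]
  ring

theorem abs_quad_le (A : Matrix (Fin n) (Fin n) ℝ) (v : EuclideanSpace ℝ (Fin n)) :
    |quad A v| ≤ ‖Matrix.toEuclideanCLM (𝕜 := ℝ) A‖ * ‖v‖ ^ 2 := by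
  rw [quad_eq_inner, sq, ← mul_assoc]
  refine (abs_real_inner_le_norm _ _).trans ?_
  gcongr
  exact ContinuousLinearMap.le_opNorm _ _

theorem Matrix.IsSymm.inner_toEuclideanCLM {A : Matrix (Fin n) (Fin n) ℝ} (hA : A.IsSymm)
    (a b : EuclideanSpace ℝ (Fin n)) :
    ⟪Matrix.toEuclideanCLM (𝕜 := ℝ) A a, b⟫ = ⟪Matrix.toEuclideanCLM (𝕜 := ℝ) A b, a⟫ := by
  simp only [PiLp.inner_apply, Matrix.ofLp_toEuclideanCLM, Matrix.mulVec, dotProduct,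
    RCLike.inner_apply, conj_trivial, Finset.mul_sum]
  rw [Finset.sum_comm]
  refine Finset.sum_congr rfl fun i _ => Finset.sum_congr rfl fun j _ => ?_
  rw [hA.apply i j]
  ring

/-- Every quadratic form `⟨S v, v⟩` is represented by a symmetric matrix. -/
theorem exists_isSymm_quad_eq_inner
    (S : EuclideanSpace ℝ (Fin n) →L[ℝ] EuclideanSpace ℝ (Fin n)) :
    ∃ H : Matrix (Fin n) (Fin n) ℝ, H.IsSymm ∧ ∀ v, quad H v = ⟪S v, v⟫ := by
  let B := (Matrix.toEuclideanCLM (n := Fin n) (𝕜 := ℝ)).symm S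
  refine ⟨(1 / 2 : ℝ) • (B + B.transpose), ?_, fun v => ?_⟩
  · rw [Matrix.IsSymm, Matrix.transpose_smul, Matrix.transpose_add, Matrix.transpose_transpose,
      add_comm]
  · rw [quad_smul, quad_add, quad_transpose, quad_eq_inner]
    simp only [B, StarAlgEquiv.apply_symm_apply]
    ring

theorem Matrix.IsSymm.abs_apply_le {H : Matrix (Fin n) (Fin n) ℝ} (hH : H.IsSymm) {K : ℝ}
    (hK : ∀ v, |quad H v| ≤ K * ‖v‖ ^ 2) (i j : Fin n) : |H i j| ≤ 3 * K := by
  let e : Fin n → EuclideanSpace ℝ (Fin n) := fun i => EuclideanSpace.single i 1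
  have he (i : Fin n) : ‖e i‖ = 1 := by simp [e]
  have hinner (i j : Fin n) : ⟪Matrix.toEuclideanCLM (𝕜 := ℝ) H (e j), e i⟫ = H i j := by
    simp [e, EuclideanSpace.inner_single_right, Matrix.ofLp_toEuclideanCLM]
  have hpol : 2 * H i j = quad H (e i + e j) - quad H (e i) - quad H (e j) := by
    simp only [quad_eq_inner, map_add, inner_add_left, inner_add_right, hinner]
    rw [hH.apply i j]
    ring
  have hK0 : 0 ≤ K := by
    have := (abs_nonneg _).trans (hK (e i))
    rwa [he, one_pow, mul_one] at this
  have h1 := hK (e i + e j)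
  have h2 := hK (e i)
  have h3 := hK (e j)
  have h4 : K * ‖e i + e j‖ ^ 2 ≤ K * (1 + 1) ^ 2 := by
    gcongr
    refine (norm_add_le _ _).trans ?_
    rw [he, he]
  rw [he, one_pow, mul_one] at h2 h3
  rw [abs_le] at h1 h2 h3 ⊢
  constructor <;> linarith [h1.1, h1.2, h2.1, h2.2, h3.1, h3.2]

theorem Matrix.IsSymm.posSemidef_of_quad_nonneg {A : Matrix (Fin n) (Fin n) ℝ} (hA : A.IsSymm)
    (h : ∀ v, 0 ≤ quad A v) : A.PosSemidef := by
  rw [Matrix.posSemidef_iff_dotProduct_mulVec]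
  refine ⟨by rwa [Matrix.IsHermitian, Matrix.conjTranspose_eq_transpose_of_trivial], fun x => ?_⟩
  refine (h (WithLp.toLp 2 x)).trans (le_of_eq ?_)
  simp only [quad, dotProduct, Matrix.mulVec, Finset.mul_sum, star_trivial]
  refine Finset.sum_congr rfl fun i _ => Finset.sum_congr rfl fun j _ => ?_
  ring

theorem tendsto_quad {H : ℕ → Matrix (Fin n) (Fin n) ℝ} {A : Matrix (Fin n) (Fin n) ℝ}
    (h : Tendsto H atTop (𝓝 A)) (v : EuclideanSpace ℝ (Fin n)) :
    Tendsto (fun k => quad (H k) v) atTop (𝓝 (quad A v)) := by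
  have hij (i j : Fin n) : Tendsto (fun k => H k i j) atTop (𝓝 (A i j)) :=
    tendsto_pi_nhds.1 (tendsto_pi_nhds.1 h i) j
  exact tendsto_finsetSum _ fun i _ => tendsto_finsetSum _ fun j _ =>
    ((hij i j).mul_const _).mul_const _

theorem Matrix.exists_tendsto_subseq_of_bounded {H : ℕ → Matrix (Fin n) (Fin n) ℝ} {C : ℝ}
    (hH : ∀ k i j, |H k i j| ≤ C) :
    ∃ (A : Matrix (Fin n) (Fin n) ℝ) (φ : ℕ → ℕ), StrictMono φ ∧
      Tendsto (H ∘ φ) atTop (𝓝 A) := by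
  have hcpt : IsCompact (Set.pi Set.univ fun _ : Fin n => Set.pi Set.univ fun _ : Fin n =>
      Set.Icc (-C) C) :=
    isCompact_univ_pi fun _ => isCompact_univ_pi fun _ => isCompact_Icc
  obtain ⟨A, -, φ, hφ, hA⟩ := hcpt.tendsto_subseq (X := Fin n → Fin n → ℝ) (x := H)
    fun k i _ j _ => abs_le.1 (hH k i j)
  exact ⟨A, φ, hφ, hA⟩

theorem twiceDiffAt_of_isLittleO {w : EuclideanSpace ℝ (Fin n) → ℝ}
    {x g : EuclideanSpace ℝ (Fin n)} {H : Matrix (Fin n) (Fin n) ℝ}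
    (h : (fun y => w y - w x - ⟪g, y - x⟫ - (1 / 2) * quad H (y - x)) =o[𝓝 x]
      fun y => ‖y - x‖ ^ 2) : TwiceDiffAt w x g H := by
  refine ⟨?_, h⟩
  rw [hasGradientAt_iff_isLittleO]
  have hlin : (fun y : EuclideanSpace ℝ (Fin n) => ‖y - x‖ ^ 2) =o[𝓝 x] fun y => y - x := by
    have h1 : (fun y : EuclideanSpace ℝ (Fin n) => ‖y - x‖) =o[𝓝 x] fun _ => (1 : ℝ) := by
      rw [Asymptotics.isLittleO_one_iff]
      have : Tendsto (fun y : EuclideanSpace ℝ (Fin n) => ‖y - x‖) (𝓝 x) (𝓝 ‖x - x‖) :=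
        Continuous.tendsto (by fun_prop) x
      simpa using this
    have h2 := h1.mul_isBigO (Asymptotics.isBigO_refl (fun y => ‖y - x‖) (𝓝 x))
    simp only [one_mul, ← sq] at h2
    exact h2.of_norm_right
  have hq : (fun y => (1 / 2) * quad H (y - x)) =O[𝓝 x] fun y => ‖y - x‖ ^ 2 := by
    refine Asymptotics.IsBigO.const_mul_left (Asymptotics.IsBigO.of_bound
      ‖Matrix.toEuclideanCLM (𝕜 := ℝ) H‖ (Eventually.of_forall fun y => ?_)) _
    rw [Real.norm_eq_abs, norm_pow, norm_norm]
    exact abs_quad_le H (y - x)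
  refine ((h.trans hlin).add (hq.trans_isLittleO hlin)).congr_left fun y => ?_
  ring

end Matrices

section UpperContactJets

open Metric

variable {n : ℕ}

/-- Subtracting the jet and adding a multiple of `‖· - x₀‖ ^ 2` makes a quasi-convex function
convex. -/
theorem QCOn.convexOn_sub_jet {U : Set (EuclideanSpace ℝ (Fin n))}
    {w : EuclideanSpace ℝ (Fin n) → ℝ} {lam : ℝ} (hqc : QCOn lam U w)
    (x₀ p₀ : EuclideanSpace ℝ (Fin n)) (A₀ : Matrix (Fin n) (Fin n) ℝ) {m : ℝ}
    (hm : lam + ‖Matrix.toEuclideanCLM (𝕜 := ℝ) A₀‖ ≤ m) :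
    ConvexOn ℝ U fun y => w y - ⟪p₀, y - x₀⟫ - 1 / 2 * quad A₀ (y - x₀) + m / 2 * ‖y - x₀‖ ^ 2 := by
  let D : EuclideanSpace ℝ (Fin n) →L[ℝ] EuclideanSpace ℝ (Fin n) :=
    (m - lam) • ContinuousLinearMap.id ℝ _ - Matrix.toEuclideanCLM (𝕜 := ℝ) A₀
  have hDv (v : EuclideanSpace ℝ (Fin n)) : ⟪D v, v⟫ = (m - lam) * ‖v‖ ^ 2 - quad A₀ v := by
    simp [D, inner_sub_left, real_inner_smul_left, quad_eq_inner]
  have hD (v : EuclideanSpace ℝ (Fin n)) : 0 ≤ ⟪D v, v⟫ := by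
    rw [hDv]
    have h1 := (le_abs_self _).trans (abs_quad_le A₀ v)
    have h2 : ‖Matrix.toEuclideanCLM (𝕜 := ℝ) A₀‖ * ‖v‖ ^ 2 ≤ (m - lam) * ‖v‖ ^ 2 := by
      gcongr
      linarith
    linarith
  have h := (convexOn_quadratic hD x₀ (- (lam • x₀) - p₀)
    (lam / 2 * ‖x₀‖ ^ 2 + ⟪p₀, x₀⟫)).subset (Set.subset_univ U) hqc.1
  refine (hqc.add h).congr fun y _ => ?_
  have e : ‖y‖ ^ 2 = ‖y - x₀‖ ^ 2 + 2 * ⟪x₀, y⟫ - ‖x₀‖ ^ 2 := by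
    rw [norm_sub_sq_real, real_inner_comm x₀ y]
    ring
  simp only [Pi.add_apply, hDv, e, inner_sub_left, inner_sub_right, inner_neg_left,
    real_inner_smul_left]
  ring

theorem QCOn.hasGradientAt_of_upperContactJet {U : Set (EuclideanSpace ℝ (Fin n))}
    (hU : IsOpen U) {w : EuclideanSpace ℝ (Fin n) → ℝ} {lam : ℝ} (hlam : 0 ≤ lam)
    (hqc : QCOn lam U w) {x₀ p₀ : EuclideanSpace ℝ (Fin n)} (hx₀ : x₀ ∈ U)
    {A₀ : Matrix (Fin n) (Fin n) ℝ} (hjet : UpperContactJet w x₀ p₀ A₀) :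
    HasGradientAt w p₀ x₀ := by
  set m := lam + ‖Matrix.toEuclideanCLM (𝕜 := ℝ) A₀‖ with hm
  have hm0 : 0 ≤ m := by positivity
  have hconv := hqc.convexOn_sub_jet x₀ p₀ A₀ hm.ge
  obtain ⟨r, hr, hball⟩ := nhds_basis_closedBall.mem_iff.1
    (inter_mem (hU.mem_nhds hx₀) hjet)
  obtain ⟨g, hg⟩ := hconv.exists_isSubgradientOn hU hx₀
  obtain rfl : g = 0 := by
    refine hg.eq_of_isUpperContactOn hr (fun y hy => (hball hy).1) hm0 fun y hy => ?_
    have := (hball hy).2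
    simp only [Set.mem_ofPred_eq] at this
    simp [quad_eq_inner] at this ⊢
    linarith
  rw [hasGradientAt_iff_isLittleO]
  have hsq : (fun y : EuclideanSpace ℝ (Fin n) => ‖y - x₀‖ ^ 2) =o[𝓝 x₀] fun y => y - x₀ := by
    have h := (hasGradientAt_iff_isLittleO.1 (twiceDiffAt_of_isLittleO
      (w := fun y => ‖y - x₀‖ ^ 2) (x := x₀) (g := 0) (H := (2 : ℝ) • 1) ?_).1)
    · simpa using h
    · refine (Asymptotics.isLittleO_zero _ _).congr_left fun y => ?_
      simp [quad_smul, quad_one]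
  refine Asymptotics.IsBigO.trans_isLittleO (Asymptotics.IsBigO.of_bound m ?_) hsq
  filter_upwards [closedBall_mem_nhds x₀ hr] with y hy
  have h1 := hg y (hball hy).1
  have h2 := (hball hy).2
  have h3 := abs_le.1 (abs_quad_le A₀ (y - x₀))
  have h4 : 0 ≤ lam * ‖y - x₀‖ ^ 2 := by positivity
  have h5 : m * ‖y - x₀‖ ^ 2 =
      lam * ‖y - x₀‖ ^ 2 + ‖Matrix.toEuclideanCLM (𝕜 := ℝ) A₀‖ * ‖y - x₀‖ ^ 2 := by
    rw [hm]; ring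
  have h6 : quad A₀ 0 = 0 := by simp [quad_eq_inner]
  simp only [Set.mem_ofPred_eq] at h2
  simp only [sub_self, inner_zero_left, inner_zero_right, norm_zero, h6] at h1
  have h7 := mul_nonneg hm0 (sq_nonneg ‖y - x₀‖)
  rw [norm_pow, norm_norm, Real.norm_eq_abs, abs_le]
  constructor <;> linarith [h3.1, h3.2]

theorem QCOn.exists_twiceDiffAt_near {U : Set (EuclideanSpace ℝ (Fin n))}
    (hU : IsOpen U) {w : EuclideanSpace ℝ (Fin n) → ℝ} {lam : ℝ} (hlam : 0 ≤ lam)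
    (hqc : QCOn lam U w) {x₀ p₀ : EuclideanSpace ℝ (Fin n)} (hx₀ : x₀ ∈ U)
    {A₀ : Matrix (Fin n) (Fin n) ℝ} (hA₀ : A₀.IsSymm) (hjet : UpperContactJet w x₀ p₀ A₀)
    {E : Set (EuclideanSpace ℝ (Fin n))} (hE : ∃ V ∈ 𝓝 x₀, volume (V \ E) = 0)
    {ε : ℝ} (hε : 0 < ε) :
    ∃ x ∈ E, ∃ g H, ‖x - x₀‖ < ε ∧ ‖g - p₀‖ < ε ∧ H.IsSymm ∧ TwiceDiffAt w x g H ∧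
      ∀ v, quad A₀ v - (lam + ‖Matrix.toEuclideanCLM (𝕜 := ℝ) A₀‖) * ‖v‖ ^ 2 ≤ quad H v ∧
        quad H v ≤ quad A₀ v + ε * ‖v‖ ^ 2 := by
  set T := Matrix.toEuclideanCLM (𝕜 := ℝ) A₀ with hT
  set m := lam + ‖T‖ with hm
  have hm0 : 0 ≤ m := by positivity
  set u : EuclideanSpace ℝ (Fin n) → ℝ := fun y =>
    w y - ⟪p₀, y - x₀⟫ - 1 / 2 * quad A₀ (y - x₀) + m / 2 * ‖y - x₀‖ ^ 2 with hu
  have hconv : ConvexOn ℝ U u := hqc.convexOn_sub_jet x₀ p₀ A₀ hm.ge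
  obtain ⟨N, hN, hNE⟩ := hE
  obtain ⟨r, hr, hball⟩ := nhds_basis_closedBall.mem_iff.1
    (inter_mem (inter_mem (hU.mem_nhds hx₀) hN) hjet)
  have htouch : ∀ y ∈ closedBall x₀ r,
      u y ≤ u x₀ + (m + ε) / 2 * ‖y - x₀‖ ^ 2 - ε / 2 * ‖y - x₀‖ ^ 2 := by
    intro y hy
    have h := (hball hy).2
    have h0 : quad A₀ 0 = 0 := by simp [quad_eq_inner]
    simp only [Set.mem_ofPred_eq] at h
    simp only [hu, sub_self, inner_zero_right, norm_zero, h0]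
    linarith
  have hη : 0 < ε / (1 + ‖T‖ + m) := by positivity
  obtain ⟨x, hxE, hx, g, S, ρ, hg, hρ, hρU, hsub, hcontact, hexp⟩ :=
    hconv.exists_isLittleO_of_touching volume hU hr (fun y hy => (hball hy).1.1)
      (by positivity) (by positivity) htouch
      (measure_mono_null (Set.sdiff_subset_sdiff_left fun y hy => (hball hy).1.2) hNE) hη
  have hηε : ε / (1 + ‖T‖ + m) * (1 + ‖T‖ + m) = ε := div_mul_cancel₀ _ (by positivity)
  obtain ⟨H, hH, hHS⟩ := exists_isSymm_quad_eq_inner S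
  have hquad (v : EuclideanSpace ℝ (Fin n)) :
      quad (H + A₀ - m • 1) v = ⟪S v, v⟫ + quad A₀ v - m * ‖v‖ ^ 2 := by
    rw [quad_sub, quad_add, quad_smul, quad_one, hHS]
  refine ⟨x, hxE, g + p₀ + T (x - x₀) - m • (x - x₀), H + A₀ - m • 1, ?_, ?_, ?_, ?_,
    fun v => ⟨?_, ?_⟩⟩
  · refine hx.trans_le (div_le_self hε.le ?_)
    linarith [norm_nonneg T]
  · have e : g + p₀ + T (x - x₀) - m • (x - x₀) - p₀ = g + T (x - x₀) - m • (x - x₀) := by abel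
    rw [e]
    calc _ ≤ ‖g‖ + ‖T (x - x₀)‖ + ‖m • (x - x₀)‖ :=
          (norm_sub_le _ _).trans (by gcongr; exact norm_add_le _ _)
      _ ≤ ‖g‖ + ‖T‖ * ‖x - x₀‖ + m * ‖x - x₀‖ := by
          rw [norm_smul, Real.norm_of_nonneg hm0]
          gcongr
          exact T.le_opNorm _
      _ ≤ ‖g‖ + ‖T‖ * (ε / (1 + ‖T‖ + m)) + m * (ε / (1 + ‖T‖ + m)) := by gcongr
      _ < ε := by linarith
  · exact (hH.add hA₀).sub (Matrix.isSymm_one.smul m)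
  · refine twiceDiffAt_of_isLittleO (hexp.congr_left fun y => ?_)
    have e : y - x₀ = (y - x) + (x - x₀) := by abel
    have hsymm := hA₀.inner_toEuclideanCLM (x - x₀) (y - x)
    rw [← hT] at hsymm
    have hgrad : ⟪g + p₀ + T (x - x₀) - m • (x - x₀), y - x⟫ =
        ⟪g, y - x⟫ + ⟪p₀, y - x⟫ + ⟪T (x - x₀), y - x⟫ - m * ⟪y - x, x - x₀⟫ := by
      rw [inner_sub_left, inner_add_left, inner_add_left, real_inner_smul_left,
        real_inner_comm (y - x) (x - x₀)]
    simp only [hu]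
    rw [hgrad, hquad, quad_eq_inner A₀, quad_eq_inner A₀, quad_eq_inner A₀, ← hT, e,
      norm_add_sq_real, map_add, inner_add_left, inner_add_right, inner_add_right,
      inner_add_right, hsymm]
    ring
  · rw [hquad]
    have h := inner_self_nonneg_of_isLittleO (F := fun y => u y - u x - ⟪g, y - x⟫) ?_ hexp v
    · linarith
    · filter_upwards [closedBall_mem_nhds x hρ] with y hy
      have := hsub y (hρU hy)
      linarith
  · rw [hquad]
    have h := inner_self_nonneg_of_isLittleO
      (F := fun y => (m + ε) / 2 * ‖y - x‖ ^ 2 - (u y - u x - ⟪g, y - x⟫))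
      (S := (m + ε) • ContinuousLinearMap.id ℝ _ - S) ?_
      (hexp.neg_left.congr_left fun y => ?_) v
    · simp [inner_sub_left, real_inner_smul_left] at h
      linarith
    · filter_upwards [closedBall_mem_nhds x hρ] with y hy
      have := hcontact y hy
      linarith
    · rw [sub_apply, smul_apply, ContinuousLinearMap.id_apply,
        inner_sub_left ((m + ε) • (y - x)), real_inner_smul_left, real_inner_self_eq_norm_sq]
      ring

end UpperContactJets

/-- (Upper Contact Jets Theorem) Let `w` be `lam`-quasi-convex on an open set `U` with an
upper contact jet `(p₀, A₀)` at `x₀ ∈ U`, and let `E` have full measure in a neighborhood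
of `x₀`. Then there is a sequence `x_j ∈ E`, `x_j → x₀`, at which `w` is twice
differentiable, with `Dw(x_j) → p₀ = Dw(x₀)` and `D²w(x_j) → A ≤ A₀`. -/
theorem stmt_12 {n : ℕ} (U : Set (EuclideanSpace ℝ (Fin n)))
    (hU : IsOpen U) (hUc : Convex ℝ U)
    (w : EuclideanSpace ℝ (Fin n) → ℝ) (lam : ℝ) (hlam : 0 ≤ lam)
    (hqc : QCOn lam U w)
    (x₀ : EuclideanSpace ℝ (Fin n)) (hx₀ : x₀ ∈ U)
    (p₀ : EuclideanSpace ℝ (Fin n)) (A₀ : Matrix (Fin n) (Fin n) ℝ) (hA₀ : A₀.IsSymm)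
    (hjet : UpperContactJet w x₀ p₀ A₀)
    (E : Set (EuclideanSpace ℝ (Fin n)))
    (hE : ∃ V ∈ 𝓝 x₀, volume (V \ E) = 0) :
    ∃ (x : ℕ → EuclideanSpace ℝ (Fin n)) (g : ℕ → EuclideanSpace ℝ (Fin n))
      (H : ℕ → Matrix (Fin n) (Fin n) ℝ) (A : Matrix (Fin n) (Fin n) ℝ),
        (∀ j, x j ∈ E) ∧ Tendsto x atTop (𝓝 x₀) ∧
        (∀ j, (H j).IsSymm ∧ TwiceDiffAt w (x j) (g j) (H j)) ∧
        HasGradientAt w p₀ x₀ ∧ Tendsto g atTop (𝓝 p₀) ∧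
        A.IsSymm ∧ Tendsto H atTop (𝓝 A) ∧ (A₀ - A).PosSemidef := by
  have hnear (j : ℕ) := hqc.exists_twiceDiffAt_near hU hlam hx₀ hA₀ hjet hE
    (ε := 1 / ((j : ℝ) + 1)) (by positivity)
  choose x hxE g H hx hg hH hdiff hbound using hnear
  set T := Matrix.toEuclideanCLM (𝕜 := ℝ) A₀
  have hlim := tendsto_one_div_add_atTop_nhds_zero_nat (𝕜 := ℝ)
  have hle (j : ℕ) : 1 / ((j : ℝ) + 1) ≤ 1 := by
    rw [div_le_one (by positivity)]
    linarith [(Nat.cast_nonneg j : (0 : ℝ) ≤ j)]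
  have hquad (j : ℕ) (v : EuclideanSpace ℝ (Fin n)) :
      |quad (H j) v| ≤ (lam + 2 * ‖T‖ + 1) * ‖v‖ ^ 2 := by
    have h1 := abs_le.1 (abs_quad_le A₀ v)
    have h2 := hbound j v
    have h3 : 1 / ((j : ℝ) + 1) * ‖v‖ ^ 2 ≤ 1 * ‖v‖ ^ 2 := by
      gcongr
      exact hle j
    have h4 : 0 ≤ lam * ‖v‖ ^ 2 := by positivity
    have h5 : 0 ≤ ‖T‖ * ‖v‖ ^ 2 := by positivity
    have h6 := sq_nonneg ‖v‖
    rw [abs_le]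
    constructor <;> linarith [h1.1, h1.2, h2.1, h2.2]
  obtain ⟨A, φ, hφ, hA⟩ := Matrix.exists_tendsto_subseq_of_bounded
    fun j => (hH j).abs_apply_le (hquad j)
  have hAsymm : A.IsSymm := Matrix.IsSymm.ext fun i j =>
    tendsto_nhds_unique (tendsto_pi_nhds.1 (tendsto_pi_nhds.1 hA j) i)
      ((tendsto_pi_nhds.1 (tendsto_pi_nhds.1 hA i) j).congr fun k => ((hH (φ k)).apply i j).symm)
  have htend {z : ℕ → EuclideanSpace ℝ (Fin n)} {a : EuclideanSpace ℝ (Fin n)}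
      (hz : ∀ j, ‖z j - a‖ < 1 / ((j : ℝ) + 1)) : Tendsto (z ∘ φ) atTop (𝓝 a) :=
    (tendsto_iff_norm_sub_tendsto_zero.2
      (squeeze_zero (fun _ => norm_nonneg _) (fun j => (hz j).le) hlim)).comp hφ.tendsto_atTop
  refine ⟨x ∘ φ, g ∘ φ, H ∘ φ, A, fun j => hxE _, htend hx, fun j => ⟨hH _, hdiff _⟩,
    hqc.hasGradientAt_of_upperContactJet hU hlam hx₀ hjet, htend hg, hAsymm, hA,
    (hA₀.sub hAsymm).posSemidef_of_quad_nonneg fun v => ?_⟩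
  rw [quad_sub, sub_nonneg]
  have h1 : Tendsto (fun k => quad A₀ v + 1 / ((φ k : ℝ) + 1) * ‖v‖ ^ 2) atTop
      (𝓝 (quad A₀ v + 0 * ‖v‖ ^ 2)) :=
    ((hlim.comp hφ.tendsto_atTop).mul_const _).const_add _
  rw [zero_mul, add_zero] at h1
  exact le_of_tendsto_of_tendsto' (tendsto_quad hA v) h1 fun k => (hbound (φ k) v).2
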